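/- With notation as above, the map κ_μ : L^∞(ν) → π_T(X)′ is positive, contractive, and faithful on positive elements: if f ∈ L^∞(ν) with f ≥ 0 and κ_μ(f) = 0, then f = 0. -/

import Mathlib

open scoped ComplexOrder InnerProductSpace

noncomputable section

/-- A matrix over a star ring is positive if it is of the form `Nᴴ * N`. -/
def MatPos {A : Type*} [Ring A] [StarRing A] {n : ℕ}
    (M : Matrix (Fin n) (Fin n) A) : Prop :=
  ∃ N : Matrix (Fin n) (Fin n) A, M = N.conjTranspose * N

/-- `T` is completely positive if the induced entrywise maps on matrices are positive. -/
def CompletelyPositiveFun {A B : Type*} [Ring A] [StarRing A] [Ring B] [StarRing B]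
    (T : A → B) : Prop :=
  ∀ (n : ℕ) (M : Matrix (Fin n) (Fin n) A), MatPos M → MatPos (M.map T)

/-- `(π, K, V)` is a Stinespring representation of `T : X → B(H)`:
`T x = V* (π x) V` for all `x`. -/
def IsStinespring {X : Type*} [NormedRing X] [StarRing X] [CStarRing X]
    [NormedAlgebra ℂ X] [StarModule ℂ X]
    {H K : Type*} [NormedAddCommGroup H] [InnerProductSpace ℂ H] [CompleteSpace H]
    [NormedAddCommGroup K] [InnerProductSpace ℂ K] [CompleteSpace K]
    (T : X → (H →L[ℂ] H)) (π : X →⋆ₐ[ℂ] (K →L[ℂ] K)) (V : H →L[ℂ] K) : Prop :=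
  ∀ x : X, T x = (ContinuousLinearMap.adjoint V).comp ((π x).comp V)

/-- Minimality: the closed linear span of `π(X) V H` is all of `K`. -/
def IsMinimalStinespring {X : Type*} [NormedRing X] [StarRing X] [CStarRing X]
    [NormedAlgebra ℂ X] [StarModule ℂ X]
    {H K : Type*} [NormedAddCommGroup H] [InnerProductSpace ℂ H] [CompleteSpace H]
    [NormedAddCommGroup K] [InnerProductSpace ℂ K] [CompleteSpace K]
    (π : X →⋆ₐ[ℂ] (K →L[ℂ] K)) (V : H →L[ℂ] K) : Prop :=
  (Submodule.span ℂ {k : K | ∃ (x : X) (h : H), k = π x (V h)}).topologicalClosure = ⊤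

open MeasureTheory

section CPMeasure

variable {X : Type*} [NormedRing X] [StarRing X] [CStarRing X]
  [NormedAlgebra ℂ X] [StarModule ℂ X]
variable {H K : Type*} [NormedAddCommGroup H] [InnerProductSpace ℂ H] [CompleteSpace H]
  [NormedAddCommGroup K] [InnerProductSpace ℂ K] [CompleteSpace K]
variable {S : Type*} [MeasurableSpace S]

/-- `μ` is a CP-measure on `(S, F)` with values in the von Neumann algebra `M`:
each `μ(Δ)` is a CP map from `X` into `M`, and `μ` is countably additive in the weak
sense (against all vector functionals, hence against all normal functionals). -/
def IsCPMeasure (M : VonNeumannAlgebra H) (μ : Set S → X → (H →L[ℂ] H)) : Prop :=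
  (∀ Δ : Set S, MeasurableSet Δ →
      IsLinearMap ℂ (μ Δ) ∧ CompletelyPositiveFun (μ Δ) ∧ ∀ x : X, μ Δ x ∈ M) ∧
  (∀ Δ : ℕ → Set S, (∀ i, MeasurableSet (Δ i)) → Pairwise (Function.onFun Disjoint Δ) →
    ∀ (x : X) (ξ η : H), ⟪ξ, μ (⋃ i, Δ i) x η⟫_ℂ = ∑' i, ⟪ξ, μ (Δ i) x η⟫_ℂ)

/-- The sequence `e` with `∑ ‖e n‖² = 1` determines the normal state
`ρ(A) = ∑ₙ ⟨e n, A (e n)⟩` on `B(H)`; faithfulness on `M` is required. -/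
def IsNormalFaithfulStateOn (M : VonNeumannAlgebra H) (e : ℕ → H) : Prop :=
  (∑' n, (‖e n‖ : ℝ) ^ 2 = 1) ∧
  ∀ A : H →L[ℂ] H, A ∈ M → A.IsPositive → (∑' n, ⟪e n, A (e n)⟫_ℂ) = 0 → A = 0

/-- `ν` is equivalent (mutually absolutely continuous) to the scalar measure
`ρ ∘ μ : Δ ↦ ∑ₙ ⟨e n, μ(Δ)(1) (e n)⟩`. -/
def IsEquivalentBaseMeasure (μ : Set S → X → (H →L[ℂ] H)) (e : ℕ → H)
    (ν : Measure S) : Prop :=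
  ∀ Δ : Set S, MeasurableSet Δ → (ν Δ = 0 ↔ (∑' n, ⟪e n, μ Δ 1 (e n)⟫_ℂ) = 0)

/-- `R` satisfies the defining property of `κ_μ(f)`: for every vector functional
`⟨ξ, · η⟩`, every `x ∈ X`, and every `ν`-density `g` of the complex measure
`Δ ↦ ⟨ξ, μ(Δ)(x) η⟩`, one has `⟨ξ, (V* R π(x) V) η⟩ = ∫ f g dν`, i.e. weakly
`V* R π(x) V = ∫ f(s) dμ(s, x)`. -/
def IsKappa (μ : Set S → X → (H →L[ℂ] H)) (ν : Measure S)
    (π : X →⋆ₐ[ℂ] (K →L[ℂ] K)) (V : H →L[ℂ] K) (f : S → ℂ) (R : K →L[ℂ] K) : Prop :=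
  ∀ (x : X) (ξ η : H) (g : S → ℂ), Integrable g ν →
    (∀ Δ : Set S, MeasurableSet Δ → ⟪ξ, μ Δ x η⟫_ℂ = ∫ s in Δ, g s ∂ν) →
    ⟪ξ, ((ContinuousLinearMap.adjoint V).comp (R.comp ((π x).comp V))) η⟫_ℂ
      = ∫ s, f s * g s ∂ν

end CPMeasure

section CompletelyPositive

variable {X : Type*} [Ring X] [StarRing X]
variable {H : Type*} [NormedAddCommGroup H] [InnerProductSpace ℂ H] [CompleteSpace H]

/-- The sesquilinear form induced by `φ : X → B(H)` on finite formal sums `∑ i, x i ⊗ h i`. -/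
def kernelForm (φ : X → (H →L[ℂ] H)) {n : ℕ} (x : Fin n → X) (h k : Fin n → H) : ℂ :=
  ∑ i, ∑ j, ⟪h i, φ (star (x i) * x j) (k j)⟫_ℂ

theorem CompletelyPositiveFun.exists_gram {φ : X → (H →L[ℂ] H)} (hφ : CompletelyPositiveFun φ)
    {n : ℕ} (x : Fin n → X) :
    ∃ N : Matrix (Fin n) (Fin n) (H →L[ℂ] H),
      ∀ i j, φ (star (x i) * x j) = ∑ k, star (N k i) * N k j := by
  obtain _ | n := n
  · exact ⟨0, fun i => i.elim0⟩
  let R : Matrix (Fin (n + 1)) (Fin (n + 1)) X := Matrix.of fun k j => if k = 0 then x j else 0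
  obtain ⟨N, hN⟩ := hφ _ (R.conjTranspose * R) ⟨R, rfl⟩
  refine ⟨N, fun i j => ?_⟩
  have h := congrFun (congrFun hN i) j
  have hR : (R.conjTranspose * R) i j = star (x i) * x j := by
    simp [R, Matrix.mul_apply]
  rw [Matrix.map_apply, hR] at h
  simpa [Matrix.mul_apply] using h

theorem kernelForm_eq_sum_inner {φ : X → (H →L[ℂ] H)} {n : ℕ} {x : Fin n → X}
    {N : Matrix (Fin n) (Fin n) (H →L[ℂ] H)}
    (hN : ∀ i j, φ (star (x i) * x j) = ∑ k, star (N k i) * N k j) (h k : Fin n → H) :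
    kernelForm φ x h k = ∑ l, ⟪∑ i, N l i (h i), ∑ j, N l j (k j)⟫_ℂ := by
  simp only [kernelForm, hN, sum_inner, inner_sum, sum_apply, mul_apply_eq_comp,
    ContinuousLinearMap.star_eq_adjoint, ContinuousLinearMap.adjoint_inner_right]
  calc _ = ∑ i, ∑ l, ∑ j, ⟪N l i (h i), N l j (k j)⟫_ℂ :=
        Finset.sum_congr rfl fun _ _ => Finset.sum_comm
    _ = ∑ l, ∑ i, ∑ j, ⟪N l i (h i), N l j (k j)⟫_ℂ := Finset.sum_comm
    _ = _ := Finset.sum_congr rfl fun _ _ => Finset.sum_comm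

theorem CompletelyPositiveFun.kernelForm_self_nonneg {φ : X → (H →L[ℂ] H)}
    (hφ : CompletelyPositiveFun φ) {n : ℕ} (x : Fin n → X) (h : Fin n → H) :
    0 ≤ kernelForm φ x h h := by
  obtain ⟨N, hN⟩ := hφ.exists_gram x
  rw [kernelForm_eq_sum_inner hN]
  exact Finset.sum_nonneg fun l _ => by
    rw [inner_self_eq_norm_sq_to_K]
    positivity

theorem CompletelyPositiveFun.norm_kernelForm_le {φ : X → (H →L[ℂ] H)}
    (hφ : CompletelyPositiveFun φ) {n : ℕ} (x : Fin n → X) (h k : Fin n → H) :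
    ‖kernelForm φ x h k‖ ≤ ((kernelForm φ x h h).re + (kernelForm φ x k k).re) / 2 := by
  obtain ⟨N, hN⟩ := hφ.exists_gram x
  simp only [kernelForm_eq_sum_inner hN, Complex.re_sum, ← Finset.sum_add_distrib,
    Finset.sum_div]
  refine (norm_sum_le _ _).trans (Finset.sum_le_sum fun l _ => ?_)
  generalize (∑ i, N l i (h i)) = a
  generalize (∑ i, N l i (k i)) = b
  have ha : (⟪a, a⟫_ℂ).re = ‖a‖ ^ 2 := inner_self_eq_norm_sq (𝕜 := ℂ) a
  have hb : (⟪b, b⟫_ℂ).re = ‖b‖ ^ 2 := inner_self_eq_norm_sq (𝕜 := ℂ) b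
  rw [ha, hb]
  nlinarith [norm_inner_le_norm (𝕜 := ℂ) a b, sq_nonneg (‖a‖ - ‖b‖)]

theorem CompletelyPositiveFun.inner_apply_star_mul_self_nonneg {φ : X → (H →L[ℂ] H)}
    (hφ : CompletelyPositiveFun φ) (x : X) (ξ : H) : 0 ≤ ⟪ξ, φ (star x * x) ξ⟫_ℂ := by
  simpa [kernelForm] using hφ.kernelForm_self_nonneg ![x] ![ξ]

theorem CompletelyPositiveFun.isPositive_apply_one {φ : X → (H →L[ℂ] H)}
    (hφ : CompletelyPositiveFun φ) : (φ 1).IsPositive := by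
  obtain ⟨N, hN⟩ := hφ.exists_gram ![1]
  have h : φ 1 = star (N 0 0) * N 0 0 := by simpa using hN 0 0
  rw [h, ← ContinuousLinearMap.nonneg_iff_isPositive]
  exact star_mul_self_nonneg _

theorem CompletelyPositiveFun.norm_inner_apply_le {φ : X → (H →L[ℂ] H)}
    (hφ : CompletelyPositiveFun φ) (x : X) (ξ η : H) :
    ‖⟪ξ, φ x η⟫_ℂ‖ ≤ ((⟪ξ, φ (star 1 * 1) ξ⟫_ℂ).re + (⟪η, φ (star x * x) η⟫_ℂ).re) / 2 := by
  simpa [kernelForm, Fin.sum_univ_two] using hφ.norm_kernelForm_le ![1, x] ![ξ, 0] ![0, η]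

theorem CompletelyPositiveFun.eq_zero_of_apply_one_eq_zero {φ : X → (H →L[ℂ] H)}
    (hφ : CompletelyPositiveFun φ) (h : φ 1 = 0) (x : X) : φ x = 0 := by
  obtain ⟨N, hN⟩ := hφ.exists_gram ![1, x]
  have h₀ : ∑ k, star (N k 0) * N k 0 = 0 := by simpa [h] using (hN 0 0).symm
  have h₁ : ∀ k, N k 0 = 0 := fun k => by
    rw [Finset.sum_eq_zero_iff_of_nonneg fun k _ => star_mul_self_nonneg _] at h₀
    exact CStarRing.star_mul_self_eq_zero_iff _ |>.1 (h₀ k (Finset.mem_univ k))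
  simpa [h₁] using hN 0 1

end CompletelyPositive

section Density

variable {S : Type*} [MeasurableSpace S] {ν : Measure S}

theorem exists_real_density [IsFiniteMeasure ν] (m : Set S → ℝ)
    (hsum : ∀ Δ : ℕ → Set S, (∀ i, MeasurableSet (Δ i)) → Pairwise (Function.onFun Disjoint Δ) →
      HasSum (fun i => m (Δ i)) (m (⋃ i, Δ i)))
    (hac : ∀ Δ, MeasurableSet Δ → ν Δ = 0 → m Δ = 0) :
    ∃ g : S → ℝ, Integrable g ν ∧ ∀ Δ, MeasurableSet Δ → m Δ = ∫ s in Δ, g s ∂ν := by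
  classical
  let s : SignedMeasure S :=
    { measureOf' := fun Δ => if MeasurableSet Δ then m Δ else 0
      empty' := by simpa using hac ∅ .empty measure_empty
      not_measurable' := fun Δ hΔ => if_neg hΔ
      m_iUnion' := fun Δ hΔ hd => by
        simpa [hΔ, MeasurableSet.iUnion hΔ] using hsum Δ hΔ hd }
  have hs : ∀ Δ, MeasurableSet Δ → s Δ = m Δ := fun Δ hΔ => if_pos hΔ
  have hsν : s ≪ᵥ ν.toENNRealVectorMeasure := .mk fun Δ hΔ h => by
    rw [Measure.toENNRealVectorMeasure_apply_measurable hΔ] at h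
    rw [hs Δ hΔ, hac Δ hΔ h]
  refine ⟨s.rnDeriv ν, s.integrable_rnDeriv ν, fun Δ hΔ => ?_⟩
  rw [← hs Δ hΔ, ← withDensityᵥ_apply (s.integrable_rnDeriv ν) hΔ,
    s.withDensityᵥ_rnDeriv_eq ν hsν]

theorem exists_complex_density [IsFiniteMeasure ν] (m : Set S → ℂ)
    (hsum : ∀ Δ : ℕ → Set S, (∀ i, MeasurableSet (Δ i)) → Pairwise (Function.onFun Disjoint Δ) →
      HasSum (fun i => m (Δ i)) (m (⋃ i, Δ i)))
    (hac : ∀ Δ, MeasurableSet Δ → ν Δ = 0 → m Δ = 0) :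
    ∃ g : S → ℂ, Integrable g ν ∧ ∀ Δ, MeasurableSet Δ → m Δ = ∫ s in Δ, g s ∂ν := by
  obtain ⟨a, ha, hma⟩ := exists_real_density (ν := ν) (fun Δ => (m Δ).re)
    (fun Δ hΔ hd => Complex.hasSum_re (hsum Δ hΔ hd)) (fun Δ hΔ h => by simp [hac Δ hΔ h])
  obtain ⟨b, hb, hmb⟩ := exists_real_density (ν := ν) (fun Δ => (m Δ).im)
    (fun Δ hΔ hd => Complex.hasSum_im (hsum Δ hΔ hd)) (fun Δ hΔ h => by simp [hac Δ hΔ h])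
  have ha' : Integrable (fun s => (a s : ℂ)) ν := ha.ofReal
  have hb' : Integrable (fun s => (b s : ℂ) * Complex.I) ν := hb.ofReal.mul_const _
  refine ⟨fun s => (a s : ℂ) + (b s : ℂ) * Complex.I, ha'.add hb', fun Δ hΔ => ?_⟩
  rw [integral_add ha'.integrableOn hb'.integrableOn, integral_mul_const, integral_complex_ofReal,
    integral_complex_ofReal, ← hma Δ hΔ, ← hmb Δ hΔ]
  exact (Complex.re_add_im _).symm

theorem ae_norm_le_of_forall_norm_setIntegral_le {g : S → ℂ} {p : S → ℝ} (hg : Integrable g ν)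
    (hp : Integrable p ν)
    (h : ∀ Δ, MeasurableSet Δ → ‖∫ s in Δ, g s ∂ν‖ ≤ ∫ s in Δ, p s ∂ν) :
    ∀ᵐ s ∂ν, ‖g s‖ ≤ p s := by
  have hz : ∀ z : ℂ, ∀ᵐ s ∂ν, (z * g s).re ≤ ‖z‖ * p s := fun z => by
    refine ae_le_of_forall_setIntegral_le (hg.const_mul z).re (hp.const_mul _) fun Δ hΔ _ => ?_
    have hre : ∫ s in Δ, (z * g s).re ∂ν = (∫ s in Δ, z * g s ∂ν).re :=
      integral_re (hg.const_mul z).integrableOn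
    rw [integral_const_mul] at hre ⊢
    calc ∫ s in Δ, (z * g s).re ∂ν = _ := hre
      _ ≤ ‖z * ∫ s in Δ, g s ∂ν‖ := Complex.re_le_norm _
      _ ≤ _ := by rw [norm_mul]; gcongr; exact h Δ hΔ
  have hd := ae_all_iff.2 fun n => hz (TopologicalSpace.denseSeq ℂ n)
  have hp0 : 0 ≤ᵐ[ν] p := ae_nonneg_of_forall_setIntegral_nonneg hp fun Δ hΔ _ =>
    (norm_nonneg _).trans (h Δ hΔ)
  filter_upwards [hd, hp0] with s hs h0
  have hall : ∀ z : ℂ, (z * g s).re ≤ ‖z‖ * p s :=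
    isClosed_property (TopologicalSpace.denseRange_denseSeq ℂ)
      (isClosed_le (by fun_prop) (by fun_prop)) hs
  have hc := hall (star (g s))
  have hsq : (star (g s) * g s).re = ‖g s‖ ^ 2 := by
    rw [← Complex.normSq_eq_norm_sq, Complex.normSq_apply]
    simp
  rw [hsq, norm_star] at hc
  rcases (norm_nonneg (g s)).eq_or_lt with h0' | h0'
  · exact h0'.symm.trans_le h0
  · nlinarith

theorem ae_nonneg_of_forall_setIntegral_nonneg_complex {g : S → ℂ} (hg : Integrable g ν)
    (h : ∀ Δ, MeasurableSet Δ → 0 ≤ ∫ s in Δ, g s ∂ν) : ∀ᵐ s ∂ν, 0 ≤ g s := by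
  have hre : ∀ Δ, ∫ s in Δ, (g s).re ∂ν = (∫ s in Δ, g s ∂ν).re := fun Δ =>
    integral_re hg.integrableOn
  filter_upwards [ae_norm_le_of_forall_norm_setIntegral_le hg hg.re fun Δ hΔ => by
    exact (Complex.re_eq_norm.2 (h Δ hΔ)).ge.trans (hre Δ).ge] with s hs
  exact Complex.re_eq_norm.1 ((Complex.re_le_norm _).antisymm hs)

end Density

section Span

variable {X : Type*} [NormedRing X] [StarRing X] [NormedAlgebra ℂ X]
variable {H K : Type*} [NormedAddCommGroup H] [InnerProductSpace ℂ H]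
  [NormedAddCommGroup K] [InnerProductSpace ℂ K] [CompleteSpace K]

theorem exists_eq_sum_of_mem_span {π : X →⋆ₐ[ℂ] (K →L[ℂ] K)} {V : H →L[ℂ] K} {u : K}
    (hu : u ∈ Submodule.span ℂ {k : K | ∃ (x : X) (h : H), k = π x (V h)}) :
    ∃ (n : ℕ) (x : Fin n → X) (h : Fin n → H), u = ∑ i, π (x i) (V (h i)) := by
  obtain ⟨n, c, g, rfl⟩ := Submodule.mem_span_set'.1 hu
  choose x h hxh using fun i => (g i).2
  exact ⟨n, x, fun i => c i • h i, by simp [hxh]⟩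

theorem exists_eq_sum_eq_sum_of_mem_span {π : X →⋆ₐ[ℂ] (K →L[ℂ] K)} {V : H →L[ℂ] K} {u v : K}
    (hu : u ∈ Submodule.span ℂ {k : K | ∃ (x : X) (h : H), k = π x (V h)})
    (hv : v ∈ Submodule.span ℂ {k : K | ∃ (x : X) (h : H), k = π x (V h)}) :
    ∃ (n : ℕ) (x : Fin n → X) (h k : Fin n → H),
      u = ∑ i, π (x i) (V (h i)) ∧ v = ∑ i, π (x i) (V (k i)) := by
  obtain ⟨n, x, h, rfl⟩ := exists_eq_sum_of_mem_span hu
  obtain ⟨m, y, k, rfl⟩ := exists_eq_sum_of_mem_span hv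
  exact ⟨n + m, Fin.append x y, Fin.append h 0, Fin.append 0 k, by simp [Fin.sum_univ_add],
    by simp [Fin.sum_univ_add]⟩

end Span

section CPMeasureLemmas

variable {X : Type*} [NormedRing X] [StarRing X] [NormedAlgebra ℂ X]
variable {H K : Type*} [NormedAddCommGroup H] [InnerProductSpace ℂ H] [CompleteSpace H]
  [NormedAddCommGroup K] [InnerProductSpace ℂ K] [CompleteSpace K]
variable {S : Type*} [MeasurableSpace S]
variable {M : VonNeumannAlgebra H} {μ : Set S → X → (H →L[ℂ] H)}

theorem IsCPMeasure.completelyPositive (hμ : IsCPMeasure M μ) {Δ : Set S}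
    (hΔ : MeasurableSet Δ) : CompletelyPositiveFun (μ Δ) :=
  (hμ.1 Δ hΔ).2.1

theorem IsCPMeasure.inner_empty (hμ : IsCPMeasure M μ) (x : X) (ξ η : H) :
    ⟪ξ, μ ∅ x η⟫_ℂ = 0 := by
  have h := hμ.2 (fun _ => ∅) (fun _ => .empty) (fun _ _ _ => by simp [Function.onFun]) x ξ η
  simpa [tsum_const] using h

theorem IsCPMeasure.inner_union (hμ : IsCPMeasure M μ) (x : X) (ξ η : H) {A B : Set S}
    (hA : MeasurableSet A) (hB : MeasurableSet B) (hAB : Disjoint A B) :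
    ⟪ξ, μ (A ∪ B) x η⟫_ℂ = ⟪ξ, μ A x η⟫_ℂ + ⟪ξ, μ B x η⟫_ℂ := by
  have hm : ∀ b, MeasurableSet (cond b A B) := by simp [hA, hB]
  have hd : Pairwise (Function.onFun Disjoint fun b => cond b A B) := by
    rintro (_ | _) (_ | _) h
    exacts [(h rfl).elim, hAB.symm, hAB, (h rfl).elim]
  have h := hμ.2 (fun i => ⋃ b ∈ Encodable.decode₂ Bool i, cond b A B)
    (fun i => .iUnion fun b => .iUnion fun _ => hm b)
    (Encodable.iUnion_decode₂_disjoint_on hd) x ξ η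
  rw [Encodable.iUnion_decode₂, ← Set.union_eq_iUnion,
    tsum_iUnion_decode₂ (fun E => ⟪ξ, μ E x η⟫_ℂ) (hμ.inner_empty x ξ η)] at h
  simpa [add_comm] using h

theorem IsCPMeasure.summable_inner_self (hμ : IsCPMeasure M μ) (x : X) (ξ : H)
    {Δ : ℕ → Set S} (hΔ : ∀ i, MeasurableSet (Δ i)) (hd : Pairwise (Function.onFun Disjoint Δ)) :
    Summable fun i => (⟪ξ, μ (Δ i) (star x * x) ξ⟫_ℂ).re := by
  set m : Set S → ℝ := fun E => (⟪ξ, μ E (star x * x) ξ⟫_ℂ).re with hm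
  have hnn : ∀ E, MeasurableSet E → 0 ≤ m E := fun E hE =>
    (Complex.nonneg_iff.1 ((hμ.completelyPositive hE).inner_apply_star_mul_self_nonneg x ξ)).1
  have hadd : ∀ A B, MeasurableSet A → MeasurableSet B → Disjoint A B →
      m (A ∪ B) = m A + m B := fun A B hA hB hAB => by
    simp only [hm, hμ.inner_union _ _ _ hA hB hAB, Complex.add_re]
  have hU : ∀ n, MeasurableSet (⋃ i ∈ Finset.range n, Δ i) := fun n =>
    Finset.measurableSet_biUnion _ fun i _ => hΔ i
  have hsum : ∀ n, ∑ i ∈ Finset.range n, m (Δ i) = m (⋃ i ∈ Finset.range n, Δ i) := by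
    intro n
    induction n with
    | zero => simp [hm, hμ.inner_empty]
    | succ n ih =>
      rw [Finset.sum_range_succ, ih, ← hadd _ _ (hU n) (hΔ n), Finset.range_add_one,
        Finset.set_biUnion_insert, Set.union_comm]
      exact Set.disjoint_iUnion₂_left.2 fun i hi => hd (Finset.mem_range.1 hi).ne
  refine summable_of_sum_range_le (c := m Set.univ) (fun i => hnn _ (hΔ i)) fun n => ?_
  have h := hadd _ _ (hU n) (hU n).compl disjoint_compl_right
  rw [Set.union_compl_self] at h
  rw [hsum n, h]
  exact le_add_of_nonneg_right (hnn _ (hU n).compl)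

theorem IsCPMeasure.hasSum_inner (hμ : IsCPMeasure M μ) (x : X) (ξ η : H)
    {Δ : ℕ → Set S} (hΔ : ∀ i, MeasurableSet (Δ i)) (hd : Pairwise (Function.onFun Disjoint Δ)) :
    HasSum (fun i => ⟪ξ, μ (Δ i) x η⟫_ℂ) ⟪ξ, μ (⋃ i, Δ i) x η⟫_ℂ := by
  rw [hμ.2 Δ hΔ hd]
  exact (Summable.of_norm_bounded
    (((hμ.summable_inner_self 1 ξ hΔ hd).add (hμ.summable_inner_self x η hΔ hd)).div_const 2)
    fun i => (hμ.completelyPositive (hΔ i)).norm_inner_apply_le x ξ η).hasSum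

theorem IsCPMeasure.apply_one_eq_zero_iff (hμ : IsCPMeasure M μ) {e : ℕ → H}
    (hρ : IsNormalFaithfulStateOn M e) {ν : Measure S} (hν : IsEquivalentBaseMeasure μ e ν)
    {Δ : Set S} (hΔ : MeasurableSet Δ) : ν Δ = 0 ↔ μ Δ 1 = 0 := by
  rw [hν Δ hΔ]
  refine ⟨hρ.2 _ ((hμ.1 Δ hΔ).2.2 1) (hμ.completelyPositive hΔ).isPositive_apply_one,
    fun h => by simp [h]⟩

theorem IsCPMeasure.exists_density (hμ : IsCPMeasure M μ) {e : ℕ → H}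
    (hρ : IsNormalFaithfulStateOn M e) {ν : Measure S} [IsFiniteMeasure ν]
    (hν : IsEquivalentBaseMeasure μ e ν) (x : X) (ξ η : H) :
    ∃ g : S → ℂ, Integrable g ν ∧
      ∀ Δ, MeasurableSet Δ → ⟪ξ, μ Δ x η⟫_ℂ = ∫ s in Δ, g s ∂ν := by
  refine exists_complex_density (fun Δ => ⟪ξ, μ Δ x η⟫_ℂ)
    (fun Δ hΔ hd => hμ.hasSum_inner x ξ η hΔ hd) fun Δ hΔ h => ?_
  simp [(hμ.completelyPositive hΔ).eq_zero_of_apply_one_eq_zero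
    ((hμ.apply_one_eq_zero_iff hρ hν hΔ).1 h) x]

theorem inner_sum_apply_eq {π : X →⋆ₐ[ℂ] (K →L[ℂ] K)} {V : H →L[ℂ] K} {R : K →L[ℂ] K}
    (hR : ∀ x, R * π x = π x * R) {n : ℕ} (x : Fin n → X) (h k : Fin n → H) :
    ⟪∑ i, π (x i) (V (h i)), R (∑ j, π (x j) (V (k j)))⟫_ℂ =
      ∑ i, ∑ j, ⟪h i, ((ContinuousLinearMap.adjoint V).comp
        (R.comp ((π (star (x i) * x j)).comp V))) (k j)⟫_ℂ := by
  simp only [map_sum, sum_inner, inner_sum, ContinuousLinearMap.comp_apply,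
    ContinuousLinearMap.adjoint_inner_right]
  rw [Finset.sum_comm]
  refine Finset.sum_congr rfl fun i _ => Finset.sum_congr rfl fun j _ => ?_
  have h₁ : R (π (star (x i) * x j) (V (k j))) = star (π (x i)) (R (π (x j) (V (k j)))) := by
    have := DFunLike.congr_fun (hR (star (x i))) (π (x j) (V (k j)))
    rw [map_star] at this
    rw [map_mul, map_star]
    exact this
  rw [h₁, ContinuousLinearMap.star_eq_adjoint, ContinuousLinearMap.adjoint_inner_right]

theorem IsStinespring.inner_sum_eq_kernelForm [CStarRing X] [StarModule ℂ X]
    {φ : X → (H →L[ℂ] H)}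
    {π : X →⋆ₐ[ℂ] (K →L[ℂ] K)} {V : H →L[ℂ] K} (hst : IsStinespring φ π V) {n : ℕ}
    (x : Fin n → X) (h k : Fin n → H) :
    ⟪∑ i, π (x i) (V (h i)), ∑ j, π (x j) (V (k j))⟫_ℂ = kernelForm φ x h k := by
  have := inner_sum_apply_eq (π := π) (V := V) (R := 1) (fun x => by simp) x h k
  rw [one_apply_eq_self] at this
  rw [this]
  simp only [kernelForm, hst _]
  rfl

theorem IsCPMeasure.exists_kernelForm_density (hμ : IsCPMeasure M μ) {e : ℕ → H}
    (hρ : IsNormalFaithfulStateOn M e) {ν : Measure S} [IsFiniteMeasure ν]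
    (hν : IsEquivalentBaseMeasure μ e ν) (π : X →⋆ₐ[ℂ] (K →L[ℂ] K)) (V : H →L[ℂ] K)
    {n : ℕ} (x : Fin n → X) (h k : Fin n → H) :
    ∃ g : S → ℂ, Integrable g ν ∧
      (∀ Δ, MeasurableSet Δ → kernelForm (μ Δ) x h k = ∫ s in Δ, g s ∂ν) ∧
      ∀ (f : S → ℂ) (R : K →L[ℂ] K), Measurable f → (∃ C : ℝ, ∀ s, ‖f s‖ ≤ C) →
        (∀ x, R * π x = π x * R) → IsKappa μ ν π V f R →
        ⟪∑ i, π (x i) (V (h i)), R (∑ j, π (x j) (V (k j)))⟫_ℂ = ∫ s, f s * g s ∂ν := by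
  choose g hg hgd using fun i j => hμ.exists_density hρ hν (star (x i) * x j) (h i) (k j)
  refine ⟨fun s => ∑ i, ∑ j, g i j s,
    integrable_finsetSum _ fun i _ => integrable_finsetSum _ fun j _ => hg i j,
    fun Δ hΔ => ?_, fun f R hf ⟨C, hC⟩ hR hκ => ?_⟩
  · rw [integral_finsetSum _ fun i _ =>
      (integrable_finsetSum _ fun j _ => hg i j).integrableOn]
    refine Finset.sum_congr rfl fun i _ => ?_
    rw [integral_finsetSum _ fun j _ => (hg i j).integrableOn]
    exact Finset.sum_congr rfl fun j _ => hgd i j Δ hΔ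
  · have hfg : ∀ i j, Integrable (fun s => f s * g i j s) ν := fun i j =>
      (hg i j).bdd_mul hf.aestronglyMeasurable (.of_forall hC)
    simp only [inner_sum_apply_eq hR, Finset.mul_sum]
    rw [integral_finsetSum _ fun i _ => integrable_finsetSum _ fun j _ => hfg i j]
    refine Finset.sum_congr rfl fun i _ => ?_
    rw [integral_finsetSum _ fun j _ => hfg i j]
    exact Finset.sum_congr rfl fun j _ => hκ _ _ _ _ (hg i j) (hgd i j)

theorem IsMinimalStinespring.dense_span [CStarRing X] [StarModule ℂ X]
    {π : X →⋆ₐ[ℂ] (K →L[ℂ] K)} {V : H →L[ℂ] K}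
    (hmin : IsMinimalStinespring π V) :
    DenseRange ((↑) : Submodule.span ℂ {k : K | ∃ (x : X) (h : H), k = π x (V h)} → K) := by
  rw [denseRange_subtype_val]
  exact Submodule.dense_iff_topologicalClosure_eq_top.2 hmin

section Kappa

variable {e : ℕ → H} {ν : Measure S} [IsFiniteMeasure ν] {π : X →⋆ₐ[ℂ] (K →L[ℂ] K)}
  {V : H →L[ℂ] K} {f : S → ℂ} {R : K →L[ℂ] K}

theorem IsKappa.isPositive [CStarRing X] [StarModule ℂ X]
    (hκ : IsKappa μ ν π V f R) (hμ : IsCPMeasure M μ)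
    (hρ : IsNormalFaithfulStateOn M e) (hν : IsEquivalentBaseMeasure μ e ν)
    (hmin : IsMinimalStinespring π V) (hR : ∀ x, R * π x = π x * R)
    (hf : Measurable f) (hfC : ∃ C : ℝ, ∀ s, ‖f s‖ ≤ C) (hf₀ : ∀ s, 0 ≤ f s) :
    R.IsPositive := by
  have hnn : ∀ u : K, 0 ≤ ⟪u, R u⟫_ℂ := by
    refine isClosed_property hmin.dense_span (isClosed_le (by fun_prop) (by fun_prop)) ?_
    rintro ⟨u, hu⟩
    obtain ⟨n, x, h, rfl⟩ := exists_eq_sum_of_mem_span hu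
    obtain ⟨g, hg, hgd, hgR⟩ := hμ.exists_kernelForm_density hρ hν π V x h h
    rw [hgR f R hf hfC hR hκ]
    refine integral_nonneg_of_ae ?_
    filter_upwards [ae_nonneg_of_forall_setIntegral_nonneg_complex hg fun Δ hΔ =>
      hgd Δ hΔ ▸ (hμ.completelyPositive hΔ).kernelForm_self_nonneg x h] with s hs
    exact mul_nonneg (hf₀ s) hs
  rw [ContinuousLinearMap.isPositive_iff_complex]
  intro u
  have h := hnn u
  rw [← inner_conj_symm, Complex.nonneg_iff, Complex.conj_re, Complex.conj_im] at h
  exact ⟨Complex.ext rfl (neg_eq_zero.1 h.2.symm).symm, h.1⟩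

theorem IsKappa.norm_le [CStarRing X] [StarModule ℂ X]
    (hκ : IsKappa μ ν π V f R) (hμ : IsCPMeasure M μ)
    (hρ : IsNormalFaithfulStateOn M e) (hν : IsEquivalentBaseMeasure μ e ν)
    (hst : IsStinespring (μ Set.univ) π V)
    (hmin : IsMinimalStinespring π V) (hR : ∀ x, R * π x = π x * R)
    (hf : Measurable f) (hfC : ∃ C : ℝ, ∀ s, ‖f s‖ ≤ C) {C : ℝ} (hC₀ : 0 ≤ C)
    (hC : ∀ᵐ s ∂ν, ‖f s‖ ≤ C) : ‖R‖ ≤ C := by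
  have hb : ∀ u v : K, ‖⟪u, R v⟫_ℂ‖ ≤ C * ((‖u‖ ^ 2 + ‖v‖ ^ 2) / 2) := by
    refine isClosed_property2 hmin.dense_span (isClosed_le (by fun_prop) (by fun_prop)) ?_
    rintro ⟨u, hu⟩ ⟨v, hv⟩
    obtain ⟨n, x, h, k, rfl, rfl⟩ := exists_eq_sum_eq_sum_of_mem_span hu hv
    obtain ⟨g, hg, hgd, hgR⟩ := hμ.exists_kernelForm_density hρ hν π V x h k
    obtain ⟨a, ha, had, -⟩ := hμ.exists_kernelForm_density hρ hν π V x h h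
    obtain ⟨b, hb, hbd, -⟩ := hμ.exists_kernelForm_density hρ hν π V x k k
    have hre : ∀ {c : S → ℂ}, Integrable c ν → ∀ Δ,
        ∫ s in Δ, (c s).re ∂ν = (∫ s in Δ, c s ∂ν).re := fun hc Δ => integral_re hc.integrableOn
    have hp : Integrable (fun s => ((a s).re + (b s).re) / 2) ν := (ha.re.add hb.re).div_const 2
    have hpd : ∀ Δ, MeasurableSet Δ → ∫ s in Δ, ((a s).re + (b s).re) / 2 ∂ν =
        ((kernelForm (μ Δ) x h h).re + (kernelForm (μ Δ) x k k).re) / 2 := fun Δ hΔ => by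
      have hadd : ∫ s in Δ, ((a s).re + (b s).re) ∂ν =
          ∫ s in Δ, (a s).re ∂ν + ∫ s in Δ, (b s).re ∂ν :=
        integral_add ha.re.integrableOn hb.re.integrableOn
      rw [integral_div, hadd, hre ha, hre hb, had Δ hΔ, hbd Δ hΔ]
    have hgp := ae_norm_le_of_forall_norm_setIntegral_le hg hp fun Δ hΔ => by
      rw [hpd Δ hΔ, ← hgd Δ hΔ]
      exact (hμ.completelyPositive hΔ).norm_kernelForm_le x h k
    have hnorm : ∀ w : Fin n → H,
        ‖∑ i, π (x i) (V (w i))‖ ^ 2 = (kernelForm (μ Set.univ) x w w).re := fun w => by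
      rw [← hst.inner_sum_eq_kernelForm]
      exact (inner_self_eq_norm_sq (𝕜 := ℂ) _).symm
    rw [hgR f R hf hfC hR hκ, hnorm, hnorm, ← hpd _ .univ, Measure.restrict_univ,
      ← integral_const_mul]
    refine norm_integral_le_of_norm_le (hp.const_mul C) ?_
    filter_upwards [hgp, hC] with s hs hCs
    rw [norm_mul]
    exact mul_le_mul hCs hs (norm_nonneg _) hC₀
  refine R.opNorm_le_bound hC₀ fun v => ?_
  rcases (norm_nonneg (R v)).eq_or_lt with h₀ | h₀
  · rw [← h₀]
    positivity
  have h := hb (((‖v‖ / ‖R v‖ : ℝ) : ℂ) • R v) v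
  have hv : 0 < ‖v‖ := norm_pos_iff.2 fun hv => by simp [hv] at h₀
  rw [inner_smul_left, norm_mul, norm_smul, inner_self_eq_norm_sq_to_K] at h
  simp only [Complex.conj_ofReal, Complex.norm_real, norm_div, norm_norm, norm_pow,
    Complex.coe_algebraMap, div_mul_cancel₀ _ h₀.ne'] at h
  have h₁ : ‖v‖ / ‖R v‖ * ‖R v‖ ^ 2 = ‖v‖ * ‖R v‖ := by field_simp
  rw [h₁] at h
  nlinarith

theorem IsKappa.ae_eq_zero (hκ : IsKappa μ ν π V f 0) (hμ : IsCPMeasure M μ)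
    (hρ : IsNormalFaithfulStateOn M e) (hν : IsEquivalentBaseMeasure μ e ν)
    (hf : Measurable f) (hfC : ∃ C : ℝ, ∀ s, ‖f s‖ ≤ C) (hf₀ : ∀ s, 0 ≤ f s) :
    f =ᵐ[ν] 0 := by
  obtain ⟨C, hC⟩ := hfC
  have hE : MeasurableSet {s | f s ≠ 0} := (hf (measurableSet_singleton 0)).compl
  suffices ν {s | f s ≠ 0} = 0 from this
  rw [hν _ hE]
  suffices ∀ ξ, ⟪ξ, μ {s | f s ≠ 0} 1 ξ⟫_ℂ = 0 by simp [this]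
  intro ξ
  obtain ⟨g, hg, hgd⟩ := hμ.exists_density hρ hν 1 ξ ξ
  have hg₀ := ae_nonneg_of_forall_setIntegral_nonneg_complex hg fun Δ hΔ => by
    simpa [← hgd Δ hΔ] using
      (hμ.completelyPositive hΔ).inner_apply_star_mul_self_nonneg 1 ξ
  have hfg : Integrable (fun s => f s * g s) ν :=
    hg.bdd_mul hf.aestronglyMeasurable (.of_forall hC)
  have hint : ∫ s, f s * g s ∂ν = 0 := by simpa using (hκ 1 ξ ξ g hg hgd).symm
  have hfg₀ : ∀ᵐ s ∂ν, 0 ≤ f s * g s := hg₀.mono fun s hs => mul_nonneg (hf₀ s) hs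
  have hre : ∫ s, (f s * g s).re ∂ν = 0 := by
    have : ∫ s, (f s * g s).re ∂ν = (∫ s, f s * g s ∂ν).re := integral_re hfg
    rw [this, hint, Complex.zero_re]
  have hre₀ := (integral_eq_zero_iff_of_nonneg_ae
    (hfg₀.mono fun s hs => (Complex.nonneg_iff.1 hs).1) hfg.re).1 hre
  rw [hgd _ hE]
  refine setIntegral_eq_zero_of_ae_eq_zero ?_
  filter_upwards [hfg₀, hre₀] with s hs hs' hfs
  have : f s * g s = 0 := Complex.ext hs' (Complex.nonneg_iff.1 hs).2.symm
  exact (mul_eq_zero.1 this).resolve_left hfs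

end Kappa

end CPMeasureLemmas

/-- The map `κ_μ : L^∞(ν) → π_T(X)′` is positive, contractive, and faithful on
positive elements: if `f ≥ 0` and `κ_μ(f) = 0` then `f = 0` (in `L^∞(ν)`,
i.e. `ν`-a.e.). -/
theorem kappa_positive_contractive_faithful
    {X : Type*} [NormedRing X] [StarRing X] [CStarRing X]
    [NormedAlgebra ℂ X] [StarModule ℂ X]
    {H K : Type*} [NormedAddCommGroup H] [InnerProductSpace ℂ H] [CompleteSpace H]
    [NormedAddCommGroup K] [InnerProductSpace ℂ K] [CompleteSpace K]
    {S : Type*} [MeasurableSpace S]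
    (M : VonNeumannAlgebra H) (μ : Set S → X → (H →L[ℂ] H))
    (hμ : IsCPMeasure M μ)
    (e : ℕ → H) (hρ : IsNormalFaithfulStateOn M e)
    (ν : MeasureTheory.Measure S) [MeasureTheory.IsFiniteMeasure ν]
    (hν : IsEquivalentBaseMeasure μ e ν)
    (π : X →⋆ₐ[ℂ] (K →L[ℂ] K)) (V : H →L[ℂ] K)
    (hst : IsStinespring (μ Set.univ) π V) (hmin : IsMinimalStinespring π V)
    (κ : (S → ℂ) → (K →L[ℂ] K))
    (hκ : ∀ f : S → ℂ, Measurable f → (∃ C : ℝ, ∀ s, ‖f s‖ ≤ C) →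
      (∀ x : X, κ f * π x = π x * κ f) ∧ IsKappa μ ν π V f (κ f)) :
    -- positivity
    (∀ f : S → ℂ, Measurable f → (∃ C : ℝ, ∀ s, ‖f s‖ ≤ C) → (∀ s, 0 ≤ f s) →
        (κ f).IsPositive) ∧
    -- contractivity
    (∀ f : S → ℂ, Measurable f → (∃ C : ℝ, ∀ s, ‖f s‖ ≤ C) →
        (‖κ f‖₊ : ENNReal) ≤ MeasureTheory.eLpNorm f ⊤ ν) ∧
    -- faithfulness on positive elements
    (∀ f : S → ℂ, Measurable f → (∃ C : ℝ, ∀ s, ‖f s‖ ≤ C) → (∀ s, 0 ≤ f s) →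
        κ f = 0 → f =ᵐ[ν] 0) := by
  refine ⟨fun f hf hfC hf₀ => (hκ f hf hfC).2.isPositive hμ hρ hν hmin (hκ f hf hfC).1 hf hfC hf₀,
    fun f hf hfC => ?_, fun f hf hfC hf₀ h => ?_⟩
  · obtain ⟨C, hC⟩ := id hfC
    have hfin : eLpNorm f ⊤ ν ≠ ⊤ :=
      (memLp_top_of_bound hf.aestronglyMeasurable C (.of_forall hC)).2.ne
    have hle : ‖κ f‖ ≤ (eLpNorm f ⊤ ν).toReal := by
      refine (hκ f hf hfC).2.norm_le hμ hρ hν hst hmin (hκ f hf hfC).1 hf hfC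
        ENNReal.toReal_nonneg ?_
      filter_upwards [ae_le_eLpNormEssSup (f := f) (μ := ν)] with s hs
      rw [← toReal_enorm]
      exact ENNReal.toReal_mono hfin (by rwa [eLpNorm_exponent_top])
    rw [← enorm_eq_nnnorm, ← ENNReal.toReal_le_toReal enorm_ne_top hfin, toReal_enorm]
    exact hle
  · exact (h ▸ (hκ f hf hfC).2 : IsKappa μ ν π V f 0).ae_eq_zero hμ hρ hν hf hfC hf₀
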